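/- arXiv:2504.20027 — 2 statements merged into one kernel-verified Lean document; each statement's English description precedes it below -/
import Mathlib

section
/- Let G be a digraph, let S, T ⊆ V(G) be disjoint, and let X ⊆ V(G). Then X is an important S-T separator if and only if X is a minimal S-T separator and X is closest to T. -/
/-- A digraph on vertex type `V` is given by its arc relation `E : V → V → Prop`.
`RSet E S X` is the set of vertices reachable in `G∖X` by a directed path from
some vertex of `S∖X` (every vertex of `S∖X` reaches itself). -/
def RSet {V : Type*} (E : V → V → Prop) (S X : Finset V) : Set V :=
  {v | ∃ s ∈ S, s ∉ X ∧ Relation.ReflTransGen (fun a b => E a b ∧ b ∉ X) s v}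

/-- `X` is an `A`-`B` separator: in `G∖X` no vertex of `B∖X` is reachable from `A∖X`. -/
def IsSep {V : Type*} (E : V → V → Prop) (A B X : Finset V) : Prop :=
  ∀ b ∈ B, b ∉ RSet E A X

/-- `X` is a minimal `A`-`B` separator. -/
def IsMinSep {V : Type*} [DecidableEq V] (E : V → V → Prop) (A B X : Finset V) : Prop :=
  IsSep E A B X ∧ ∀ v ∈ X, ¬ IsSep E A B (X.erase v)

/-- `X` is an important `A`-`B` separator. -/
def IsImpSep {V : Type*} [DecidableEq V] (E : V → V → Prop) (A B X : Finset V) : Prop :=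
  IsMinSep E A B X ∧
    ¬ ∃ X' : Finset V, IsSep E A B X' ∧ X'.card ≤ X.card ∧ RSet E A X ⊂ RSet E A X'

/-- `prefBinom x c = C(x, ≤c) = Σ_{i=1}^{c} binom(x, i)`. -/
def prefBinom (x c : ℕ) : ℕ := ∑ i ∈ Finset.Icc 1 c, Nat.choose x i

/-- `X` is closest to `T`: `X` is the unique `X`-`T` separator of size at most `|X|`. -/
def IsClosest {V : Type*} (E : V → V → Prop) (X T : Finset V) : Prop :=
  ∀ Y : Finset V, IsSep E X T Y → Y.card ≤ X.card → Y = X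

section Reachability

variable {V : Type*} {E : V → V → Prop}

theorem mem_RSet_of_mem {S X : Finset V} {s : V} (hs : s ∈ S) (hX : s ∉ X) : s ∈ RSet E S X :=
  ⟨s, hs, hX, .refl⟩

theorem mem_RSet_of_arc {S X : Finset V} {u v : V} (hu : u ∈ RSet E S X) (h : E u v)
    (hv : v ∉ X) : v ∈ RSet E S X := by
  obtain ⟨s, hs, hsX, hp⟩ := hu
  exact ⟨s, hs, hsX, hp.tail ⟨h, hv⟩⟩

theorem RSet_induction {S X : Finset V} {p : V → Prop}
    (start : ∀ s ∈ S, s ∉ X → p s)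
    (step : ∀ u v, u ∈ RSet E S X → p u → E u v → v ∉ X → p v)
    {v : V} (hv : v ∈ RSet E S X) : p v := by
  obtain ⟨s, hs, hsX, hp⟩ := hv
  induction hp with
  | refl => exact start s hs hsX
  | tail hsu huv ih => exact step _ _ ⟨s, hs, hsX, hsu⟩ ih huv.1 huv.2

theorem notMem_of_mem_RSet {S X : Finset V} {v : V} (hv : v ∈ RSet E S X) : v ∉ X :=
  RSet_induction (p := (· ∉ X)) (fun _ _ h => h) (fun _ _ _ _ _ h => h) hv

theorem RSet_subset_RSet {S X Y : Finset V} (h : ∀ v ∈ RSet E S X, v ∉ Y) :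
    RSet E S X ⊆ RSet E S Y := fun _ hv =>
  RSet_induction (p := (· ∈ RSet E S Y))
    (fun _ hs hX => mem_RSet_of_mem hs (h _ (mem_RSet_of_mem hs hX)))
    (fun _ _ hu ih huv hvX => mem_RSet_of_arc ih huv (h _ (mem_RSet_of_arc hu huv hvX))) hv

/-- Every vertex of a minimal separator lies in the source set or is the head of an arc leaving
the region reachable from it. -/
theorem IsMinSep.mem_or_exists_arc [DecidableEq V] {S T X : Finset V} (hX : IsMinSep E S T X)
    {x : V} (hx : x ∈ X) : x ∈ S ∨ ∃ u ∈ RSet E S X, E u x := by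
  by_contra! hcon
  obtain ⟨hxS, hxE⟩ := hcon
  refine hX.2 x hx fun b hb hbR => hX.1 b hb ?_
  refine RSet_induction (p := (· ∈ RSet E S X)) (fun s hs hsX => ?_)
    (fun u v _ ih huv hvX => ?_) hbR
  · exact mem_RSet_of_mem hs fun h => hsX (Finset.mem_erase.2 ⟨fun e => hxS (e ▸ hs), h⟩)
  · exact mem_RSet_of_arc ih huv fun h =>
      hvX (Finset.mem_erase.2 ⟨fun e => hxE u ih (e ▸ huv), h⟩)

/-- If the region reachable from `S` avoiding a minimal separator `X` remains reachable avoiding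
`Y`, then so does every vertex of `X` outside `Y`. -/
theorem IsMinSep.mem_RSet_of_subset [DecidableEq V] {S T X Y : Finset V}
    (hX : IsMinSep E S T X) (hsub : RSet E S X ⊆ RSet E S Y) {x : V} (hx : x ∈ X)
    (hxY : x ∉ Y) : x ∈ RSet E S Y := by
  obtain hxS | ⟨u, hu, hux⟩ := hX.mem_or_exists_arc hx
  · exact mem_RSet_of_mem hxS hxY
  · exact mem_RSet_of_arc (hsub hu) hux hxY

/-- If `X` separates `S` from `T` and `Y` separates `X` from `T`, then the part of `Y` not
reachable from `S` in `G∖X` still separates `S` from `T`. -/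
theorem IsSep.of_notMem_RSet {S T X Y Z : Finset V} (hX : IsSep E S T X) (hY : IsSep E X T Y)
    (hZ : ∀ v ∈ Y, v ∉ RSet E S X → v ∈ Z) : IsSep E S T Z := by
  have start : ∀ v ∈ X, v ∉ Z → v ∈ RSet E X Y := fun v hv hvZ =>
    mem_RSet_of_mem hv fun hvY => hvZ (hZ v hvY fun h => notMem_of_mem_RSet h hv)
  intro b hb hbR
  have key : b ∈ RSet E X Y ∨ b ∈ RSet E S X := by
    refine RSet_induction (p := fun v => v ∈ RSet E X Y ∨ v ∈ RSet E S X)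
      (fun s hs hsZ => ?_) (fun u v _ ih huv hvZ => ?_) hbR
    · by_cases hsX : s ∈ X
      · exact .inl (start s hsX hsZ)
      · exact .inr (mem_RSet_of_mem hs hsX)
    · by_cases hvR : v ∈ RSet E S X
      · exact .inr hvR
      · obtain hu | hu := ih
        · exact .inl (mem_RSet_of_arc hu huv fun hvY => hvZ (hZ v hvY hvR))
        · by_cases hvX : v ∈ X
          · exact .inl (start v hvX hvZ)
          · exact .inr (mem_RSet_of_arc hu huv hvX)
  exact key.elim (hY b hb) (hX b hb)

theorem IsImpSep.isClosest [DecidableEq V] {S T X : Finset V} (hX : IsImpSep E S T X) :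
    IsClosest E X T := by
  classical
  intro Y hY hcard
  let Z := Y.filter (· ∉ RSet E S X)
  have hZ : IsSep E S T Z :=
    hX.1.1.of_notMem_RSet hY fun v hv hvR => Finset.mem_filter.2 ⟨hv, hvR⟩
  have hsub : RSet E S X ⊆ RSet E S Z :=
    RSet_subset_RSet fun v hv hvZ => (Finset.mem_filter.1 hvZ).2 hv
  have hZY : Z ⊆ Y := Finset.filter_subset _ _
  have hrev : RSet E S Z ⊆ RSet E S X := by
    by_contra h
    exact hX.2 ⟨Z, hZ, (Finset.card_le_card hZY).trans hcard, hsub, h⟩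
  have hXZ : X ⊆ Z := fun x hx => by
    by_contra hxZ
    exact notMem_of_mem_RSet (hrev (hX.1.mem_RSet_of_subset hsub hx hxZ)) hx
  exact (Finset.eq_of_subset_of_card_le (hXZ.trans hZY) hcard).symm

theorem IsMinSep.isImpSep [DecidableEq V] {S T X : Finset V} (hX : IsMinSep E S T X)
    (hc : IsClosest E X T) : IsImpSep E S T X := by
  refine ⟨hX, ?_⟩
  rintro ⟨Y, hY, hcard, hlt⟩
  have hXY : IsSep E X T Y := fun b hb hbR => hY b hb <|
    RSet_induction (p := (· ∈ RSet E S Y))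
      (fun x hx hxY => hX.mem_RSet_of_subset hlt.subset hx hxY)
      (fun _ _ _ ih huv hv => mem_RSet_of_arc ih huv hv) hbR
  rw [hc Y hXY hcard] at hlt
  exact hlt.ne rfl

end Reachability

/-- `X` is an important `S`-`T` separator iff `X` is a minimal `S`-`T`
separator and `X` is closest to `T`. -/
theorem important_iff_minimal_and_closest
    (V : Type*) [Fintype V] [DecidableEq V] (E : V → V → Prop)
    (S T X : Finset V) (hST : Disjoint S T) :
    IsImpSep E S T X ↔ IsMinSep E S T X ∧ IsClosest E X T :=
  ⟨fun h => ⟨h.1, h.isClosest⟩, fun h => h.1.isImpSep h.2⟩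
end

section
/- Let G be a digraph, let s ∈ V(G), let T' ⊆ V(G) be nonempty with s ∉ T', and let k be a positive integer. Define Reach^k(s,T') = { R_{{s}}(F) ∩ T' : F ⊆ V(G), |F| ≤ k }, the collection of subsets of T' arising as the set of vertices of T' reachable from s after deleting at most k vertices. Then |Reach^k(s,T')| ≤ 4^k · C(|T'|, ≤2k). -/
open Finset

/-- Deleting `F'` preserves reachability if `F'` avoids everything reachable after deleting
`F`. -/
lemma rSet_subset_rSet_of_disjoint {V : Type*} {E : V → V → Prop} {s : V} {F F' : Finset V}
    (h : ∀ v ∈ RSet E {s} F, v ∉ F') :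
    RSet E {s} F ⊆ RSet E {s} F' := by
  rintro v ⟨a, ha, haF, hav⟩
  refine ⟨a, ha, h a ⟨a, ha, haF, .refl⟩, ?_⟩
  induction hav with
  | refl => exact .refl
  | tail hab hbc ih => exact ih.tail ⟨hbc.1, h _ ⟨a, ha, haF, hab.tail hbc⟩⟩

section Boundary

variable {V : Type*} [Fintype V] [DecidableEq V] (E : V → V → Prop) (s : V)

open Classical in
/-- The vertices outside `R` that are equal to `s` or out-neighbours of `R`, i.e. the smallest
set separating `R` (together with a super-source preceding `s`) from the rest. -/
noncomputable def outBoundary (R : Finset V) : Finset V :=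
  {v | v ∉ R ∧ (v = s ∨ ∃ u ∈ R, E u v)}

variable {E s}

lemma mem_outBoundary {R : Finset V} {v : V} :
    v ∈ outBoundary E s R ↔ v ∉ R ∧ (v = s ∨ ∃ u ∈ R, E u v) := by
  simp [outBoundary]

lemma mem_outBoundary_of_subset {R R' : Finset V} {v : V} (hv : v ∈ outBoundary E s R)
    (h : R ⊆ R') (hv' : v ∉ R') : v ∈ outBoundary E s R' := by
  rw [mem_outBoundary] at hv ⊢
  exact ⟨hv', hv.2.imp_right fun ⟨u, hu, huv⟩ => ⟨u, h hu, huv⟩⟩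

lemma outBoundary_union_subset (X Y : Finset V) :
    outBoundary E s (X ∪ Y) ⊆ outBoundary E s X ∪ outBoundary E s Y := by
  intro v
  simp only [mem_outBoundary, mem_union]
  grind

lemma outBoundary_inter_subset (X Y : Finset V) :
    outBoundary E s (X ∩ Y) ⊆ outBoundary E s X ∪ outBoundary E s Y := by
  intro v
  simp only [mem_outBoundary, mem_union, mem_inter]
  grind

/-- The size of the boundary, counted outside a fixed set `Z`, is submodular. -/
lemma card_outBoundary_sdiff_submodular (Z X Y : Finset V) :
    #(outBoundary E s (X ∩ Y) \ Z) + #(outBoundary E s (X ∪ Y) \ Z) ≤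
      #(outBoundary E s X \ Z) + #(outBoundary E s Y \ Z) := by
  rw [← card_union_add_card_inter, ← card_union_add_card_inter (outBoundary E s X \ Z)]
  refine add_le_add (card_le_card ?_) (card_le_card ?_)
  · have h₁ := outBoundary_union_subset (E := E) (s := s) X Y
    have h₂ := outBoundary_inter_subset (E := E) (s := s) X Y
    grind
  · intro v
    simp only [mem_outBoundary, mem_union, mem_inter, mem_sdiff]
    grind

lemma card_outBoundary_submodular (X Y : Finset V) :
    #(outBoundary E s (X ∩ Y)) + #(outBoundary E s (X ∪ Y)) ≤
      #(outBoundary E s X) + #(outBoundary E s Y) := by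
  simpa using card_outBoundary_sdiff_submodular (E := E) (s := s) ∅ X Y

/-- If separating `B` is more expensive than `j`, and `X` already costs at least `j`, then adding
a single vertex of `B` to `X` makes the cost exceed `j`. -/
lemma exists_insert_lt_card_outBoundary {A B X : Finset V} {j : ℕ} (hB : B.Nonempty)
    (hX : ∀ R, A ⊆ R → Disjoint R X → j ≤ #(outBoundary E s R))
    (h : ∀ R, A ⊆ R → Disjoint R B → j < #(outBoundary E s R)) :
    ∃ b ∈ B, ∀ R, A ⊆ R → Disjoint R (insert b X) → j < #(outBoundary E s R) := by
  by_contra! hc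
  have key : ∀ D ⊆ B, ∃ R, A ⊆ R ∧ Disjoint R (X ∪ D) ∧ #(outBoundary E s R) ≤ j := by
    intro D
    induction D using Finset.induction with
    | empty =>
      intro _
      obtain ⟨b, hb⟩ := hB
      obtain ⟨R, hAR, hd, hR⟩ := hc b hb
      exact ⟨R, hAR, by grind [Finset.disjoint_left], hR⟩
    | insert b D _ ih =>
      intro hD
      obtain ⟨R, hAR, hd, hR⟩ := ih fun x hx => hD (mem_insert_of_mem hx)
      obtain ⟨R', hAR', hd', hR'⟩ := hc b (hD (mem_insert_self b D))
      refine ⟨R ∩ R', subset_inter hAR hAR', by grind [Finset.disjoint_left], ?_⟩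
      have h₁ := card_outBoundary_submodular (E := E) (s := s) R R'
      have h₂ := hX (R ∪ R') (hAR.trans subset_union_left) (by grind [Finset.disjoint_left])
      omega
  obtain ⟨R, hAR, hd, hR⟩ := key B subset_rfl
  exact absurd (h R hAR (by grind [Finset.disjoint_left])) (by omega)

lemma exists_subset_card_le_card_outBoundary {A B : Finset V} (hB : B.Nonempty) (m : ℕ)
    (h : ∀ R, A ⊆ R → Disjoint R B → m ≤ #(outBoundary E s R)) :
    ∃ B₀ ⊆ B, #B₀ ≤ m ∧ ∀ R, A ⊆ R → Disjoint R B₀ → m ≤ #(outBoundary E s R) := by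
  induction m with
  | zero => exact ⟨∅, by simp⟩
  | succ m ih =>
    obtain ⟨B₀, hB₀, hc, hm⟩ := ih fun R hA hd => (Nat.le_succ m).trans (h R hA hd)
    obtain ⟨b, hb, hlt⟩ := exists_insert_lt_card_outBoundary hB hm h
    exact ⟨insert b B₀, insert_subset hb hB₀, (card_insert_le _ _).trans (by omega), hlt⟩

/-- If no strict superset of `R` separates `B` as cheaply as `R`, this is already witnessed by
few vertices of `B`. -/
lemma exists_subset_card_le_two_mul {R B : Finset V} (hB : B.Nonempty)
    (h : ∀ R', R ⊂ R' → Disjoint R' B → #(outBoundary E s R) < #(outBoundary E s R')) :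
    ∃ B' ⊆ B, #B' ≤ 2 * #(outBoundary E s R) ∧
      ∀ v ∈ outBoundary E s R, ∀ R', R ⊆ R' → v ∈ R' → Disjoint R' B' →
        #(outBoundary E s R) < #(outBoundary E s R') := by
  obtain ⟨B₀, hB₀, hc, hm⟩ := exists_subset_card_le_card_outBoundary (E := E) (s := s) (A := R)
    hB #(outBoundary E s R) fun R' hR' hd => by
      rcases hR'.eq_or_ssubset with rfl | hlt
      · exact le_rfl
      · exact (h R' hlt hd).le
  have hb : ∀ v : V, ∃ b ∈ B, v ∈ outBoundary E s R → ∀ R', insert v R ⊆ R' →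
      Disjoint R' (insert b B₀) → #(outBoundary E s R) < #(outBoundary E s R') := by
    intro v
    by_cases hv : v ∈ outBoundary E s R
    · obtain ⟨b, hb, hlt⟩ := exists_insert_lt_card_outBoundary (E := E) (s := s)
        (A := insert v R) (X := B₀) (j := #(outBoundary E s R)) hB
        (fun R' hR' hd => hm R' ((subset_insert v R).trans hR') hd)
        (fun R' hR' hd => h R' ((ssubset_insert (mem_outBoundary.1 hv).1).trans_subset hR') hd)
      exact ⟨b, hb, fun _ => hlt⟩
    · exact ⟨hB.choose, hB.choose_spec, fun h => absurd h hv⟩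
  choose b hbB hb using hb
  refine ⟨B₀ ∪ (outBoundary E s R).image b, union_subset hB₀ ?_, ?_, ?_⟩
  · intro x hx
    obtain ⟨v, -, rfl⟩ := mem_image.1 hx
    exact hbB v
  · have h₁ := card_union_le B₀ ((outBoundary E s R).image b)
    have h₂ := card_image_le (s := outBoundary E s R) (f := b)
    omega
  · intro v hv R' hR' hvR' hd
    refine hb v hv R' (insert_subset hvR' hR') (hd.mono_right ?_)
    exact insert_subset (mem_union_right _ (mem_image_of_mem b hv)) subset_union_left

variable (E s) in
/-- `R` avoids `B`, every strict superset of `R` avoiding `B` has a larger boundary, and the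
boundary of `R` is inclusion-minimal among boundaries of sets avoiding `B`. -/
structure IsImportantSet (B R : Finset V) : Prop where
  disjoint : Disjoint R B
  lt_card : ∀ R', R ⊂ R' → Disjoint R' B → #(outBoundary E s R) < #(outBoundary E s R')
  minimal : ∀ R', Disjoint R' B → outBoundary E s R' ⊆ outBoundary E s R →
    outBoundary E s R ⊆ outBoundary E s R'

variable (E s) in
open Classical in
/-- The important sets for `B` that contain `A` and whose boundary consists of `Z` and at most
`j` further vertices. -/
noncomputable def importantSets (A B Z : Finset V) (j : ℕ) : Finset (Finset V) :=
  {R | IsImportantSet E s B R ∧ A ⊆ R ∧ Z ⊆ outBoundary E s R ∧ #(outBoundary E s R \ Z) ≤ j}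

lemma mem_importantSets {A B Z R : Finset V} {j : ℕ} :
    R ∈ importantSets E s A B Z j ↔ IsImportantSet E s B R ∧ A ⊆ R ∧ Z ⊆ outBoundary E s R ∧
      #(outBoundary E s R \ Z) ≤ j := by
  simp [importantSets]

lemma disjoint_outBoundary {R Z : Finset V} (h : Z ⊆ outBoundary E s R) : Disjoint R Z :=
  Finset.disjoint_left.2 fun _ hv hvZ => (mem_outBoundary.1 (h hvZ)).1 hv

/-- A largest set among those minimizing the boundary outside `Z`. -/
lemma exists_maximal_minimizer {A C Z : Finset V} (h : Disjoint A C) :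
    ∃ M, A ⊆ M ∧ Disjoint M C ∧
      (∀ R, A ⊆ R → Disjoint R C → #(outBoundary E s M \ Z) ≤ #(outBoundary E s R \ Z)) ∧
      ∀ R, M ⊂ R → Disjoint R C → #(outBoundary E s M \ Z) < #(outBoundary E s R \ Z) := by
  classical
  obtain ⟨M₀, hM₀, hmin⟩ := exists_min_image ({R | A ⊆ R ∧ Disjoint R C} : Finset (Finset V))
    (fun R => #(outBoundary E s R \ Z)) ⟨A, by simp [h]⟩
  obtain ⟨M, hM, hmax⟩ := exists_max_image ({R | A ⊆ R ∧ Disjoint R C ∧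
    #(outBoundary E s R \ Z) ≤ #(outBoundary E s M₀ \ Z)} : Finset (Finset V)) card
    ⟨M₀, by simpa using hM₀⟩
  simp only [mem_filter, mem_univ, true_and] at hM₀ hmin hM hmax
  refine ⟨M, hM.1, hM.2.1, fun R hA hd => hM.2.2.trans (hmin R ⟨hA, hd⟩), fun R hMR hd => ?_⟩
  by_contra! hle
  exact (card_lt_card hMR).not_ge (hmax R ⟨hM.1.trans hMR.subset, hd, hle.trans hM.2.2⟩)

lemma card_importantSets_mul_two_pow_le_aux {B : Finset V} (n : ℕ) :
    ∀ (A Z : Finset V) (j l : ℕ), 2 * j < n + l →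
      (∀ R, A ⊆ R → Disjoint R (B ∪ Z) → l ≤ #(outBoundary E s R \ Z)) →
      #(importantSets E s A B Z j) * 2 ^ l ≤ 4 ^ j := by
  induction n with
  | zero =>
    intro A Z j l hj hl
    rw [show importantSets E s A B Z j = ∅ from ?_]
    · simp
    refine eq_empty_of_forall_notMem fun R hR => ?_
    obtain ⟨hI, hA, hZ, hRj⟩ := mem_importantSets.1 hR
    have := hl R hA (disjoint_union_right.2 ⟨hI.disjoint, disjoint_outBoundary hZ⟩)
    omega
  | succ n ih =>
    intro A Z j l hj hl
    rcases (importantSets E s A B Z j).eq_empty_or_nonempty with he | ⟨R₀, hR₀⟩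
    · simp [he]
    obtain ⟨hI₀, hA₀, hZ₀, hj₀⟩ := mem_importantSets.1 hR₀
    have hd₀ := disjoint_union_right.2 ⟨hI₀.disjoint, disjoint_outBoundary hZ₀⟩
    obtain ⟨M, hAM, hMd, hmin, hmax⟩ :=
      exists_maximal_minimizer (E := E) (s := s) (Z := Z) (hd₀.mono_left hA₀)
    have hsub : ∀ R ∈ importantSets E s A B Z j, M ⊆ R := by
      intro R hR
      obtain ⟨hI, hA, hZ, -⟩ := mem_importantSets.1 hR
      have hd := disjoint_union_right.2 ⟨hI.disjoint, disjoint_outBoundary hZ⟩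
      by_contra hMR
      have h₁ := hI.lt_card (R ∪ M)
        (subset_union_left.ssubset_of_ne fun h => hMR (by rw [h]; exact subset_union_right))
        (disjoint_union_left.2 ⟨hI.disjoint, (disjoint_union_right.1 hMd).1⟩)
      have h₂ := card_outBoundary_sdiff_submodular (E := E) (s := s) Z R M
      have h₃ := hmin (R ∩ M) (subset_inter hA hAM) (hd.mono_left inter_subset_left)
      have h₄ := card_sdiff_add_card_eq_card hZ
      have h₅ := le_card_sdiff Z (outBoundary E s (R ∪ M))
      omega
    set m := #(outBoundary E s M \ Z) with hm
    have hlm : l ≤ m := hl M hAM hMd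
    have hmj : m ≤ j := (hmin R₀ hA₀ hd₀).trans hj₀
    suffices h : #(importantSets E s A B Z j) * 2 ^ m ≤ 4 ^ j from
      (Nat.mul_le_mul_left _ (Nat.pow_le_pow_right (by norm_num) hlm)).trans h
    rcases (outBoundary E s M \ Z).eq_empty_or_nonempty with he | ⟨v, hv⟩
    · have hm0 : m = 0 := by rw [hm, he, card_empty]
      have hone : importantSets E s A B Z j ⊆ {M} := by
        intro R hR
        rw [mem_singleton]
        by_contra hne
        obtain ⟨hI, hA, hZ, -⟩ := mem_importantSets.1 hR
        have h₁ := hmax R ((hsub R hR).ssubset_of_ne (Ne.symm hne))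
          (disjoint_union_right.2 ⟨hI.disjoint, disjoint_outBoundary hZ⟩)
        have h₂ : outBoundary E s M ⊆ Z := sdiff_eq_empty_iff_subset.1 he
        have h₃ := (hI.minimal M (disjoint_union_right.1 hMd).1 (h₂.trans hZ)).trans h₂
        rw [sdiff_eq_empty_iff_subset.2 h₃] at h₁
        simp at h₁
      have := card_le_card hone
      rw [hm0]
      have h4 : 1 ≤ 4 ^ j := Nat.one_le_pow _ _ (by norm_num)
      simp only [card_singleton] at this
      omega
    · have hm1 : 1 ≤ m := card_pos.2 ⟨v, hv⟩
      obtain ⟨hvM, hvZ⟩ := mem_sdiff.1 hv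
      have hcover : importantSets E s A B Z j ⊆
          importantSets E s A B (insert v Z) (j - 1) ∪
            importantSets E s (insert v M) B Z j := by
        intro R hR
        obtain ⟨hI, hA, hZ, hRj⟩ := mem_importantSets.1 hR
        by_cases hvR : v ∈ R
        · exact mem_union_right _ (mem_importantSets.2
            ⟨hI, insert_subset hvR (hsub R hR), hZ, hRj⟩)
        · have hvN := mem_outBoundary_of_subset hvM (hsub R hR) hvR
          refine mem_union_left _ (mem_importantSets.2 ⟨hI, hA, insert_subset hvN hZ, ?_⟩)
          rw [sdiff_insert, card_erase_of_mem (mem_sdiff.2 ⟨hvN, hvZ⟩)]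
          omega
      have h₁ := ih A (insert v Z) (j - 1) (m - 1) (by omega) fun R hA hd => by
        have := hmin R hA (hd.mono_right (union_subset_union_right (subset_insert v Z)))
        rw [sdiff_insert]
        have := pred_card_le_card_erase (s := outBoundary E s R \ Z) (a := v)
        omega
      have h₂ := ih (insert v M) Z j (m + 1) (by omega) fun R hR hd =>
        hmax R ((ssubset_insert (mem_outBoundary.1 hvM).1).trans_subset hR) hd
      have h₃ := (card_le_card hcover).trans (card_union_le _ _)
      obtain ⟨i, rfl⟩ : ∃ i, j = i + 1 := ⟨j - 1, by omega⟩
      obtain ⟨q, hq⟩ : ∃ q, m = q + 1 := ⟨m - 1, by omega⟩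
      rw [hq] at h₁ h₂ ⊢
      simp only [Nat.add_sub_cancel] at h₁ h₃
      have h₄ := Nat.mul_le_mul_right (2 ^ q) h₃
      rw [add_mul] at h₄
      have h₅ : #(importantSets E s (insert v M) B Z (i + 1)) * 2 ^ q ≤ 4 ^ i := by
        rw [pow_succ 2, pow_succ 2, pow_succ 4] at h₂
        linarith
      rw [pow_succ 2, pow_succ 4]
      linarith

/-- If every set containing `A` and avoiding `B ∪ Z` has at least `l` boundary vertices outside
`Z`, then there are at most `4 ^ j / 2 ^ l` important sets. -/
lemma card_importantSets_mul_two_pow_le {A B Z : Finset V} {j l : ℕ}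
    (hl : ∀ R, A ⊆ R → Disjoint R (B ∪ Z) → l ≤ #(outBoundary E s R \ Z)) :
    #(importantSets E s A B Z j) * 2 ^ l ≤ 4 ^ j :=
  card_importantSets_mul_two_pow_le_aux (2 * j + 1) A Z j l (by omega) hl

lemma card_nonempty_outBoundary_importantSets_le {B : Finset V} {j : ℕ} :
    #{R ∈ importantSets E s ∅ B ∅ j | (outBoundary E s R).Nonempty} * 2 ≤ 4 ^ j := by
  rcases ({R ∈ importantSets E s ∅ B ∅ j | (outBoundary E s R).Nonempty}).eq_empty_or_nonempty
    with he | ⟨R₀, hR₀⟩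
  · simp [he]
  obtain ⟨hR₀, hne⟩ := mem_filter.1 hR₀
  have h := card_importantSets_mul_two_pow_le (E := E) (s := s) (A := ∅) (B := B) (Z := ∅)
    (j := j) (l := 1) fun R _ hd => by
      rw [sdiff_empty, Nat.one_le_iff_ne_zero, Ne, card_eq_zero]
      intro h0
      have := (mem_importantSets.1 hR₀).1.minimal R (by simpa using hd) (by simp [h0])
      rw [h0] at this
      exact hne.ne_empty (subset_empty.1 this)
  exact (Nat.mul_le_mul_right 2 (card_le_card (filter_subset _ _))).trans (by simpa using h)

/-- Every reachable vertex set stays inside a set `R` as long as the deleted set contains the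
boundary of `R`. -/
lemma rSet_subset_of_outBoundary_subset {R F : Finset V} (h : outBoundary E s R ⊆ F) :
    RSet E {s} F ⊆ ↑R := by
  rintro v ⟨a, ha, haF, hav⟩
  rw [mem_singleton] at ha
  subst ha
  induction hav with
  | refl =>
    by_contra hs
    exact haF (h (mem_outBoundary.2 ⟨hs, Or.inl rfl⟩))
  | tail _ hbc ih =>
    by_contra hc
    exact hbc.2 (h (mem_outBoundary.2 ⟨hc, Or.inr ⟨_, ih, hbc.1⟩⟩))

lemma outBoundary_subset_of_coe_eq_rSet {C F : Finset V} (h : (C : Set V) = RSet E {s} F) :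
    outBoundary E s C ⊆ F := by
  intro v hv
  obtain ⟨hvC, hv⟩ := mem_outBoundary.1 hv
  by_contra hvF
  refine hvC (mem_coe.1 ?_)
  rw [h]
  rcases hv with rfl | ⟨u, hu, huv⟩
  · exact ⟨v, mem_singleton_self v, hvF, .refl⟩
  · rw [← mem_coe, h] at hu
    obtain ⟨a, ha, haF, hau⟩ := hu
    exact ⟨a, ha, haF, hau.tail ⟨huv, hvF⟩⟩

/-- A profile that differs from the one without deletions comes from an important set for a
small set of vertices of `T`. -/
lemma exists_isImportantSet_of_profile {T F : Finset V} {k : ℕ} (hF : #F ≤ k)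
    (hne : RSet E {s} F ∩ ↑T ≠ RSet E {s} ∅ ∩ ↑T) :
    ∃ B ⊆ T, B.Nonempty ∧ #B ≤ 2 * k ∧ ∃ R ∈ importantSets E s ∅ B ∅ k,
      (outBoundary E s R).Nonempty ∧
      RSet E {s} F ∩ ↑T = RSet E {s} (outBoundary E s R) ∩ ↑T := by
  classical
  obtain ⟨C, hC⟩ : ∃ C : Finset V, (C : Set V) = RSet E {s} F :=
    ⟨(Set.toFinite (RSet E {s} F)).toFinset, by simp⟩
  set B := T \ C
  have hCB : Disjoint C B := disjoint_sdiff
  obtain ⟨R, hCR, hRB, hmin, hmax⟩ :=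
    exists_maximal_minimizer (E := E) (s := s) (Z := ∅) hCB
  simp only [sdiff_empty] at hmin hmax
  have hRk : #(outBoundary E s R) ≤ k :=
    (hmin C subset_rfl hCB).trans
      ((card_le_card (outBoundary_subset_of_coe_eq_rSet hC)).trans hF)
  have hCsub : (C : Set V) ⊆ RSet E {s} (outBoundary E s R) := by
    rw [hC]
    refine rSet_subset_rSet_of_disjoint fun v hv hvN => ?_
    rw [← hC] at hv
    exact (mem_outBoundary.1 hvN).1 (hCR hv)
  have hprof : RSet E {s} F ∩ ↑T = RSet E {s} (outBoundary E s R) ∩ ↑T := by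
    rw [← hC]
    refine Set.Subset.antisymm (Set.inter_subset_inter_left _ hCsub) ?_
    rintro v ⟨hv, hvT⟩
    refine ⟨?_, hvT⟩
    by_contra hvC
    exact Finset.disjoint_left.1 hRB (rSet_subset_of_outBoundary_subset subset_rfl hv)
      (mem_sdiff.2 ⟨hvT, hvC⟩)
  have hNne : (outBoundary E s R).Nonempty := by
    rw [nonempty_iff_ne_empty]
    intro h0
    rw [h0] at hprof
    exact hne hprof
  have hBne : B.Nonempty := by
    rw [nonempty_iff_ne_empty]
    intro h0
    obtain ⟨v, hv⟩ := hNne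
    have h₁ := hmin univ (subset_univ _) (by simp [h0])
    have h₂ : outBoundary E s (univ : Finset V) = ∅ := by ext; simp [mem_outBoundary]
    rw [h₂, card_empty, Nat.le_zero, card_eq_zero] at h₁
    simp [h₁] at hv
  obtain ⟨B', hB'B, hB'c, hB'⟩ := exists_subset_card_le_two_mul hBne hmax
  obtain ⟨R', hRR', hR'⟩ := exists_max_image ({R' | R ⊆ R' ∧ Disjoint R' B' ∧
    #(outBoundary E s R') ≤ #(outBoundary E s R)} : Finset (Finset V)) card
    ⟨R, by simpa using hRB.mono_right hB'B⟩
  simp only [mem_filter, mem_univ, true_and] at hRR' hR'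
  obtain ⟨hRR', hd', hle'⟩ := hRR'
  have hN : outBoundary E s R = outBoundary E s R' := by
    refine eq_of_subset_of_card_le (fun v hv => ?_) hle'
    exact mem_outBoundary_of_subset hv hRR' fun hvR' => (hB' v hv R' hRR' hvR' hd').not_ge hle'
  refine ⟨B', hB'B.trans sdiff_subset, ?_, by omega, R', ?_, hN ▸ hNne, hN ▸ hprof⟩
  · rw [nonempty_iff_ne_empty]
    rintro rfl
    obtain ⟨v, hv⟩ := hNne
    have h₁ := hB' v hv univ (subset_univ _) (mem_univ _) (disjoint_empty_right _)
    have h₂ : outBoundary E s (univ : Finset V) = ∅ := by ext; simp [mem_outBoundary]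
    simp [h₂] at h₁
  · refine mem_importantSets.2 ⟨⟨hd', fun S hS hSd => ?_, fun S hSd hS => ?_⟩, empty_subset _,
      empty_subset _, by simpa [← hN] using hRk⟩
    · by_contra! hle
      exact (card_lt_card hS).not_ge (hR' S ⟨hRR'.trans hS.subset, hSd, hle.trans hle'⟩)
    · rw [← hN] at hS ⊢
      have hCS : C ⊆ S := by
        rw [← coe_subset]
        exact hCsub.trans (rSet_subset_of_outBoundary_subset hS)
      have h₁ : outBoundary E s (S ∩ R) = outBoundary E s R :=
        eq_of_subset_of_card_le
          ((outBoundary_inter_subset S R).trans (union_subset hS subset_rfl))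
          (hmin _ (subset_inter hCS hCR) (hRB.mono_left inter_subset_right))
      have h₂ : outBoundary E s (R ∪ S) ⊆ outBoundary E s R :=
        (outBoundary_union_subset R S).trans (union_subset subset_rfl hS)
      intro v hv
      refine mem_outBoundary_of_subset (h₁ ▸ hv) inter_subset_left fun hvS => ?_
      exact (hB' v hv (R ∪ S) subset_union_left (mem_union_right _ hvS)
        (disjoint_union_left.2 ⟨hRB.mono_right hB'B, hSd⟩)).not_ge (card_le_card h₂)

end Boundary

/-- the number of subsets of `T'` arising as the set of vertices of `T'`
reachable from `s` after deleting at most `k` vertices is at most `4^k · C(|T'|,≤2k)`. -/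
theorem reachability_profile_bound
    (V : Type*) [Fintype V] [DecidableEq V] (E : V → V → Prop)
    (s : V) (T' : Finset V) (hT' : T'.Nonempty) (hs : s ∉ T')
    (k : ℕ) (hk : 0 < k) :
    {P : Set V | ∃ F : Finset V, F.card ≤ k ∧ P = RSet E {s} F ∩ ↑T'}.ncard ≤
      4 ^ k * prefBinom T'.card (2 * k) := by
  classical
  let fam (B : Finset V) : Finset (Set V) :=
    {R ∈ importantSets E s ∅ B ∅ k | (outBoundary E s R).Nonempty}.image
      fun R => RSet E {s} (outBoundary E s R) ∩ ↑T'
  let U : Finset (Set V) :=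
    (Icc 1 (2 * k)).biUnion fun i => (powersetCard i T').biUnion fam
  have hfam (B : Finset V) : #(fam B) ≤ 4 ^ k / 2 :=
    card_image_le.trans ((Nat.le_div_iff_mul_le (by norm_num)).2
      card_nonempty_outBoundary_importantSets_le)
  have hU : #U ≤ prefBinom #T' (2 * k) * (4 ^ k / 2) := by
    rw [prefBinom, sum_mul]
    refine card_biUnion_le.trans (sum_le_sum fun i _ => ?_)
    rw [← card_powersetCard i T']
    exact card_biUnion_le_card_mul _ _ _ fun B _ => hfam B
  have hsub : {P : Set V | ∃ F : Finset V, F.card ≤ k ∧ P = RSet E {s} F ∩ ↑T'} ⊆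
      ↑(insert (RSet E {s} ∅ ∩ ↑T') U) := by
    rintro P ⟨F, hF, rfl⟩
    rw [mem_coe, mem_insert]
    by_cases hne : RSet E {s} F ∩ ↑T' = RSet E {s} ∅ ∩ ↑T'
    · exact Or.inl hne
    obtain ⟨B, hBT, hB, hBk, R, hR, hRne, hP⟩ := exists_isImportantSet_of_profile hF hne
    refine Or.inr (mem_biUnion.2 ⟨#B, mem_Icc.2 ⟨hB.card_pos, hBk⟩, mem_biUnion.2
      ⟨B, mem_powersetCard.2 ⟨hBT, rfl⟩, mem_image.2 ⟨R, mem_filter.2 ⟨hR, hRne⟩, hP.symm⟩⟩⟩)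
  have hpos : 1 ≤ prefBinom #T' (2 * k) := by
    refine le_trans ?_ (single_le_sum (f := fun i => Nat.choose #T' i)
      (fun _ _ => Nat.zero_le _) (mem_Icc.2 ⟨le_rfl, (by omega : 1 ≤ 2 * k)⟩))
    simpa using hT'.card_pos
  have h4 : 4 ≤ 4 ^ k := Nat.le_self_pow hk.ne' 4
  have hcard := (Set.ncard_le_ncard hsub (finite_toSet _)).trans
    ((Set.ncard_coe_finset _).trans_le (card_insert_le _ _))
  have hhalf : 4 ^ k / 2 + 1 ≤ 4 ^ k := by omega
  calc _ ≤ prefBinom #T' (2 * k) * (4 ^ k / 2) + 1 := hcard.trans (by omega)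
    _ ≤ prefBinom #T' (2 * k) * (4 ^ k / 2 + 1) := by nlinarith
    _ ≤ 4 ^ k * prefBinom #T' (2 * k) := by
      rw [mul_comm]
      exact Nat.mul_le_mul_right _ hhalf
end
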